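/- For every integer n ≥ 7, the number of words w of length n over the alphabet {1,2,3} such that w(1) = 1, w(2) = 2, no two adjacent letters of w are equal, and w is NOT a superpattern for [3]^3, equals (n−2)^2. -/

import Mathlib

/-- A word `w` of length `n` over the alphabet `{1,…,d}` (modeled as `Fin d`)
contains the pattern `p` of length `k` if some subsequence of `w` is
order-isomorphic to `p`. -/
def Contains {n k d : ℕ} (w : Fin n → Fin d) (p : Fin k → Fin d) : Prop :=
  ∃ f : Fin k → Fin n, StrictMono f ∧ ∀ a b : Fin k, w (f a) ≤ w (f b) ↔ p a ≤ p b

/-- A word over a ternary alphabet is a superpattern for `[3]^3` if it contains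
every pattern of length 3 over the ternary alphabet. -/
def Superpattern3 {n : ℕ} (w : Fin n → Fin 3) : Prop :=
  ∀ p : Fin 3 → Fin 3, Contains w p

/-- A word is minimal if no two adjacent letters are equal. -/
def MinimalWord {n : ℕ} (w : Fin n → Fin 3) : Prop :=
  ∀ (i : ℕ) (h : i + 1 < n), w ⟨i, Nat.lt_of_succ_lt h⟩ ≠ w ⟨i + 1, h⟩

/-- The words of length three over the ternary alphabet. -/
def threeWords : List (Fin 3 → Fin 3) :=
  [0, 1, 2].flatMap fun x => [0, 1, 2].flatMap fun y => [0, 1, 2].map fun z => ![x, y, z]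

/-- Two words of length three are order-isomorphic. -/
def OrderIso3 (u p : Fin 3 → Fin 3) : Prop := ∀ a b : Fin 3, u a ≤ u b ↔ p a ≤ p b

instance (u p : Fin 3 → Fin 3) : Decidable (OrderIso3 u p) :=
  inferInstanceAs (Decidable (∀ a b : Fin 3, u a ≤ u b ↔ p a ≤ p b))

/-- The base-three code of a word of length three, last letter most significant. -/
def code (u : Fin 3 → Fin 3) : ℕ := u 0 + 3 * u 1 + 9 * u 2

/-- For each pattern of length three, the codes of its realisations. -/
def realisations : List (List ℕ) :=
  (threeWords.map fun p => (threeWords.filter (OrderIso3 · p)).map code).dedup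

/-- A summary of a ternary word: its last letter, and the sets of its subsequences of
lengths one, two and three, stored as bit masks indexed by base-three codes. -/
structure Summary where
  last : Fin 3
  one : ℕ
  two : ℕ
  three : ℕ
deriving DecidableEq

namespace Summary

/-- The summary after one more letter is read. -/
def step (s : Summary) (a : Fin 3) : Summary where
  last := a
  one := s.one ||| 1 <<< (a : ℕ)
  two := s.two ||| s.one <<< (3 * a : ℕ)
  three := s.three ||| s.two <<< (9 * a : ℕ)

/-- Every pattern of length three has been seen. -/
def full (s : Summary) : Bool := realisations.all fun c => c.any fun i => s.three.testBit i

/-- The summaries reachable by a letter different from the last one. -/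
def next (s : Summary) : List Summary :=
  ([0, 1, 2].filter (· ≠ s.last)).map s.step

/-- The number of extensions by `m` letters, without equal adjacent letters, that miss a pattern. -/
def count : ℕ → Summary → ℕ
  | 0, s => if s.full then 0 else 1
  | m + 1, s => if s.full then 0 else (s.next.map (count m)).sum

/-- Depth-first search, with bounded depth, through the summaries that miss a pattern. -/
def search : ℕ → List Summary → Summary → List Summary
  | 0, v, _ => v
  | k + 1, v, s => if s.full ∨ s ∈ v then v else s.next.foldl (search k) (s :: v)

/-- The summary of a word, given as the list of its letters from last to first. -/
def ofList : List (Fin 3) → Summary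
  | [] => ⟨0, 0, 0, 0⟩
  | a :: h => (ofList h).step a

/-- The summaries that miss a pattern and extend that of the word `0, 1`. -/
def reachable : List Summary := search 40 [] (ofList [1, 0])

end Summary

open Summary

theorem next_mem_reachable :
    ∀ s ∈ reachable, ∀ t ∈ s.next, t.full = true ∨ t ∈ reachable := by
  decide +kernel

theorem third_difference_base :
    ∀ s ∈ reachable, count 8 s + 3 * count 6 s = 3 * count 7 s + count 5 s := by
  decide +kernel

section Semantics

variable (h : List (Fin 3))

theorem testBit_one (i : ℕ) :
    (ofList h).one.testBit i ↔ ∃ x : Fin 3, i = x ∧ [x].Sublist h := by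
  induction h generalizing i with
  | nil => simp [ofList]
  | cons a h ih =>
    simp only [ofList, step, Nat.testBit_or, Bool.or_eq_true, ih, List.cons_sublist_cons',
      List.nil_sublist, and_true, Nat.one_shiftLeft, Nat.testBit_two_pow, decide_eq_true_eq]
    constructor
    · rintro (⟨x, hx, hs⟩ | rfl)
      exacts [⟨x, hx, Or.inl hs⟩, ⟨a, rfl, Or.inr rfl⟩]
    · rintro ⟨x, hx, hs | rfl⟩
      exacts [Or.inl ⟨x, hx, hs⟩, Or.inr hx.symm]

theorem testBit_two (i : ℕ) :
    (ofList h).two.testBit i ↔ ∃ x y : Fin 3, i = x + 3 * y ∧ [y, x].Sublist h := by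
  induction h generalizing i with
  | nil => simp [ofList]
  | cons a h ih =>
    simp only [ofList, step, Nat.testBit_or, Bool.or_eq_true, ih, List.cons_sublist_cons' (b := a),
      Nat.testBit_shiftLeft, Bool.and_eq_true, decide_eq_true_eq, testBit_one]
    constructor
    · rintro (⟨x, y, hx, hs⟩ | ⟨hi, x, hx, hs⟩)
      exacts [⟨x, y, hx, Or.inl hs⟩, ⟨x, a, by omega, Or.inr ⟨rfl, hs⟩⟩]
    · rintro ⟨x, y, hx, hs | ⟨rfl, hs⟩⟩
      exacts [Or.inl ⟨x, y, hx, hs⟩, Or.inr ⟨by omega, x, by omega, hs⟩]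

theorem testBit_three (i : ℕ) :
    (ofList h).three.testBit i ↔
      ∃ x y z : Fin 3, i = x + 3 * y + 9 * z ∧ [z, y, x].Sublist h := by
  induction h generalizing i with
  | nil => simp [ofList]
  | cons a h ih =>
    simp only [ofList, step, Nat.testBit_or, Bool.or_eq_true, ih, List.cons_sublist_cons' (b := a),
      Nat.testBit_shiftLeft, Bool.and_eq_true, decide_eq_true_eq, testBit_two]
    constructor
    · rintro (⟨x, y, z, hx, hs⟩ | ⟨hi, x, y, hx, hs⟩)
      exacts [⟨x, y, z, hx, Or.inl hs⟩, ⟨x, y, a, by omega, Or.inr ⟨rfl, hs⟩⟩]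
    · rintro ⟨x, y, z, hx, hs | ⟨rfl, hs⟩⟩
      exacts [Or.inl ⟨x, y, z, hx, hs⟩, Or.inr ⟨by omega, x, y, by omega, hs⟩]

theorem testBit_code (u : Fin 3 → Fin 3) :
    (ofList h).three.testBit (code u) ↔ (List.ofFn u).reverse.Sublist h := by
  have hu : (List.ofFn u).reverse = [u 2, u 1, u 0] := by simp [List.ofFn_succ]
  rw [testBit_three, hu]
  constructor
  · rintro ⟨x, y, z, hx, hs⟩
    rw [code] at hx
    obtain rfl : u 0 = x := by omega
    obtain rfl : u 1 = y := by omega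
    obtain rfl : u 2 = z := by omega
    exact hs
  · exact fun hs => ⟨_, _, _, rfl, hs⟩

theorem mem_threeWords (u : Fin 3 → Fin 3) : u ∈ threeWords := by
  revert u
  decide +kernel

/-- Every pattern of length three occurs in the word whose reversal is `h`. -/
def AllPatterns : Prop :=
  ∀ p : Fin 3 → Fin 3, ∃ u : Fin 3 → Fin 3, OrderIso3 u p ∧ (List.ofFn u).reverse.Sublist h

theorem full_ofList : (ofList h).full ↔ AllPatterns h := by
  simp [full, realisations, AllPatterns, mem_threeWords, testBit_code]

variable {h}

theorem AllPatterns.cons (hh : AllPatterns h) (a : Fin 3) : AllPatterns (a :: h) := fun p =>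
  (hh p).imp fun _ hu => ⟨hu.1, hu.2.cons a⟩

end Semantics

/-- The word whose reversal is `h` has no equal adjacent letters and misses a pattern. -/
def Deficient (h : List (Fin 3)) : Prop := h.IsChain (· ≠ ·) ∧ ¬ AllPatterns h

theorem Deficient.of_cons {a : Fin 3} {h : List (Fin 3)} (hd : Deficient (a :: h)) :
    Deficient h :=
  ⟨hd.1.tail, fun hh => hd.2 (hh.cons a)⟩

/-- The number of deficient extensions by `m` letters of the word whose reversal is `h`. -/
noncomputable def extensions (h : List (Fin 3)) (m : ℕ) : ℕ :=
  Nat.card {v : Fin m → Fin 3 // Deficient ((List.ofFn v).reverse ++ h)}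

open Classical in
theorem extensions_zero (h : List (Fin 3)) :
    extensions h 0 = if Deficient h then 1 else 0 := by
  split_ifs with hd <;> simp [extensions, hd]

theorem extensions_succ (h : List (Fin 3)) (m : ℕ) :
    extensions h (m + 1) = ∑ a, extensions (a :: h) m := by
  simp only [extensions]
  rw [← Nat.card_sigma]
  refine Nat.card_congr
    { toFun := fun v => ⟨v.1 0, Fin.tail v.1, ?_⟩
      invFun := fun v => ⟨Fin.cons v.1 v.2.1, ?_⟩
      left_inv := ?_
      right_inv := ?_ }
  · simpa [List.ofFn_succ, Fin.tail_def] using v.2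
  · simpa [List.ofFn_succ] using v.2.2
  · rintro ⟨v, hv⟩
    simp
  · rintro ⟨a, v, hv⟩
    rfl

theorem extensions_eq_zero {h : List (Fin 3)} (hd : ¬ Deficient h) (m : ℕ) :
    extensions h m = 0 := by
  induction m generalizing h with
  | zero => simp [extensions_zero, hd]
  | succ m ih =>
    rw [extensions_succ]
    exact Finset.sum_eq_zero fun a _ => ih fun hc => hd hc.of_cons

theorem ofList_last (a : Fin 3) (h : List (Fin 3)) : (ofList (a :: h)).last = a := rfl

theorem sum_next (s : Summary) (f : Summary → ℕ) :
    (s.next.map f).sum = ∑ a, if a ≠ s.last then f (s.step a) else 0 := by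
  rw [Fin.sum_univ_three, next]
  obtain ⟨l, _, _, _⟩ := s
  fin_cases l <;> simp

theorem extensions_eq_count {a : Fin 3} {h : List (Fin 3)} (hc : (a :: h).IsChain (· ≠ ·))
    (m : ℕ) : extensions (a :: h) m = count m (ofList (a :: h)) := by
  induction m generalizing a h with
  | zero =>
    by_cases hf : AllPatterns (a :: h) <;>
      simp only [extensions_zero, count, Deficient, hc, full_ofList, hf, true_and, not_true,
        not_false_eq_true, if_true, if_false]
  | succ m ih =>
    by_cases hf : AllPatterns (a :: h)
    · rw [extensions_eq_zero fun hd => hd.2 hf, count, if_pos ((full_ofList _).2 hf)]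
    · rw [extensions_succ, count, if_neg (mt (full_ofList _).1 hf), sum_next]
      refine Finset.sum_congr rfl fun b _ => ?_
      rw [ofList_last]
      split_ifs with hb
      · exact ih (List.isChain_cons_cons.2 ⟨hb, hc⟩)
      · exact extensions_eq_zero (fun hd => hb (List.isChain_cons_cons.1 hd.1).1) m

theorem count_of_full {s : Summary} (hs : s.full) (m : ℕ) : count m s = 0 := by
  cases m <;> simp [count, hs]

theorem third_difference_sum {l : List Summary} {m : ℕ}
    (hl : ∀ s ∈ l, count (m + 3) s + 3 * count (m + 1) s = 3 * count (m + 2) s + count m s) :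
    (l.map (count (m + 3))).sum + 3 * (l.map (count (m + 1))).sum =
      3 * (l.map (count (m + 2))).sum + (l.map (count m)).sum := by
  simp only [← List.sum_map_mul_left, ← List.sum_map_add]
  exact congrArg List.sum (List.map_congr_left hl)

theorem third_difference {s : Summary} (hs : s ∈ reachable) {m : ℕ} (hm : 5 ≤ m) :
    count (m + 3) s + 3 * count (m + 1) s = 3 * count (m + 2) s + count m s := by
  induction m, hm using Nat.le_induction generalizing s with
  | base => exact third_difference_base s hs
  | succ m _ ih =>
    by_cases hf : s.full
    · simp [count_of_full hf]
    · simp only [count, hf]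
      refine third_difference_sum fun t ht => ?_
      rcases next_mem_reachable s hs t ht with h | h
      · simp [count_of_full h]
      · exact ih h

theorem count_start_base : ofList [1, 0] ∈ reachable ∧ count 5 (ofList [1, 0]) = 25 ∧
    count 6 (ofList [1, 0]) = 36 ∧ count 7 (ofList [1, 0]) = 49 := by
  decide +kernel

theorem count_start (k : ℕ) : count (k + 5) (ofList [1, 0]) = (k + 5) ^ 2 := by
  obtain ⟨hr, h5, h6, h7⟩ := count_start_base
  induction k using Nat.strong_induction_on with
  | _ k ih =>
    match k with
    | 0 => exact h5
    | 1 => exact h6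
    | 2 => exact h7
    | k + 3 =>
      have h := third_difference hr (m := k + 5) (by omega)
      have h0 := ih k (by omega)
      have h1 := ih (k + 1) (by omega)
      have h2 := ih (k + 2) (by omega)
      simp only [show k + 1 + 5 = k + 5 + 1 by ring, show k + 2 + 5 = k + 5 + 2 by ring,
        show k + 3 + 5 = k + 5 + 3 by ring] at *
      rw [h0, h1, h2] at h
      linarith

theorem ofFn_sublist_ofFn_iff {α : Type*} {k n : ℕ} (u : Fin k → α) (w : Fin n → α) :
    (List.ofFn u).Sublist (List.ofFn w) ↔ ∃ f : Fin k → Fin n, StrictMono f ∧ w ∘ f = u := by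
  rw [List.sublist_iff_exists_fin_orderEmbedding_get_eq]
  constructor
  · rintro ⟨f, hf⟩
    refine ⟨fun i => (f (i.cast (by simp))).cast (by simp), fun i j hij => ?_, funext fun i => ?_⟩
    · exact f.strictMono (show i.cast _ < j.cast _ from hij)
    · simpa [Fin.cast] using (hf (i.cast (by simp))).symm
  · rintro ⟨f, hf, rfl⟩
    refine ⟨OrderEmbedding.ofStrictMono
      (fun i => (f (i.cast (by simp))).cast (by simp)) fun i j hij => ?_, fun i => ?_⟩
    · exact hf (show i.cast _ < j.cast _ from hij)
    · simp [OrderEmbedding.ofStrictMono, Fin.cast]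

theorem superpattern3_iff {n : ℕ} (w : Fin n → Fin 3) :
    Superpattern3 w ↔ AllPatterns (List.ofFn w).reverse := by
  simp only [Superpattern3, AllPatterns, Contains, OrderIso3, List.reverse_sublist,
    ofFn_sublist_ofFn_iff]
  refine forall_congr' fun p => ⟨?_, ?_⟩
  · rintro ⟨f, hf, hw⟩
    exact ⟨w ∘ f, hw, f, hf, rfl⟩
  · rintro ⟨_, hu, f, hf, rfl⟩
    exact ⟨f, hf, hu⟩

theorem minimalWord_iff {n : ℕ} (w : Fin n → Fin 3) :
    MinimalWord w ↔ (List.ofFn w).reverse.IsChain (· ≠ ·) := by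
  rw [List.isChain_reverse, List.isChain_iff_getElem]
  simp only [MinimalWord, List.getElem_ofFn, List.length_ofFn]
  exact forall₂_congr fun _ _ => ne_comm

theorem card_eq_extensions (m : ℕ) :
    Nat.card {w : Fin (m + 2) → Fin 3 //
      w 0 = 0 ∧ w 1 = 1 ∧ MinimalWord w ∧ ¬ Superpattern3 w} = extensions [1, 0] m := by
  simp only [minimalWord_iff, superpattern3_iff]
  refine Nat.card_congr
    { toFun := fun w => ⟨Fin.tail (Fin.tail w.1), ?_⟩
      invFun := fun v => ⟨Fin.cons 0 (Fin.cons 1 v.1 : Fin (m + 1) → Fin 3), rfl, rfl, ?_⟩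
      left_inv := ?_
      right_inv := ?_ }
  · obtain ⟨w, h0, h1, hw⟩ := w
    simpa [Deficient, List.ofFn_succ, Fin.tail_def, h0, h1] using hw
  · simpa [Deficient, List.ofFn_succ] using v.2
  · rintro ⟨w, h0, h1, hw⟩
    refine Subtype.ext (funext fun i => ?_)
    refine Fin.cases h0.symm (fun i => Fin.cases h1.symm (fun i => rfl) i) i
  · rintro ⟨v, hv⟩
    rfl

/-- For `n ≥ 7`, the number of length-`n` words starting with the letters `1, 2`
(encoded `0, 1`), with no two adjacent letters equal, that fail to be
superpatterns for `[3]^3` equals `(n-2)²`. -/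
theorem non_superpattern_minimal_count (n : ℕ) (hn : 7 ≤ n) :
    Nat.card {w : Fin n → Fin 3 //
      w ⟨0, by omega⟩ = 0 ∧ w ⟨1, by omega⟩ = 1 ∧ MinimalWord w ∧ ¬ Superpattern3 w} =
    (n - 2) ^ 2 := by
  obtain ⟨k, rfl⟩ : ∃ k, n = k + 5 + 2 := ⟨n - 7, by omega⟩
  exact (card_eq_extensions (k + 5)).trans
    ((extensions_eq_count (by simp) _).trans (count_start k))
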